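/- Let Q ⊆ ℤ^n, Ψ : ℤ^n → (0,1/2], 0 < s < s(Q,Ψ), and let M₀ be as in the lower bound |Q'(M)| ≥ M/(4 (log₂ M)^{n+1}) for M ∈ 𝓜, M ≥ M₀. Then for every ζ > log 2 there is a constant C_ζ (depending on ζ and φ) such that for every M ∈ 𝓜 with M ≥ M₀ and every ℓ ∈ ℤ^{mn} with |ℓ| ≥ 3, |F̂_M(ℓ)| ≤ C_ζ |ℓ|^{−s} w_ζ(|ℓ|) (log M)^{n+1}. -/

import Mathlib

noncomputable section

/-- `Ψ_*(q) = Ψ(q)/|q|` (max norm on `ℤ^n`). -/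
def PsiStar {n : ℕ} (Ψ : (Fin n → ℤ) → ℝ) (q : Fin n → ℤ) : ℝ := Ψ q / ‖q‖

/-- `s(Q,Ψ) = inf {s ≥ 0 : ∑_{q ∈ Q} Ψ_*(q)^s < ∞}`. -/
def sExp {n : ℕ} (Q : Set (Fin n → ℤ)) (Ψ : (Fin n → ℤ) → ℝ) : ℝ :=
  sInf {s : ℝ | 0 ≤ s ∧ Summable fun q : Q => PsiStar Ψ q ^ s}

/-- `Q(M) = {q ∈ Q : M/2 < Ψ_*(q)^{-s} ≤ M}`. -/
def QM {n : ℕ} (Q : Set (Fin n → ℤ)) (Ψ : (Fin n → ℤ) → ℝ) (s M : ℝ) : Set (Fin n → ℤ) :=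
  {q | q ∈ Q ∧ M / 2 < PsiStar Ψ q ^ (-s) ∧ PsiStar Ψ q ^ (-s) ≤ M}

/-- `𝓜 = {2^k : k ∈ ℕ, ∑_{q ∈ Q(2^k)} Ψ_*(q)^s ≥ k^{-(n+1)}}`. -/
def Mcal {n : ℕ} (Q : Set (Fin n → ℤ)) (Ψ : (Fin n → ℤ) → ℝ) (s : ℝ) : Set ℝ :=
  {M | ∃ k : ℕ, M = 2 ^ k ∧
    (((k : ℝ) ^ (n + 1))⁻¹ : ℝ) ≤ ∑' q : QM Q Ψ s (2 ^ k), PsiStar Ψ q ^ s}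

end
/-- The set of divisors `D(ℓ) = {q ∈ ℤ^n : ∃ k ∈ ℤ^m, ℓ_{ij} = k_i q_j for all i,j}` of
`ℓ ∈ ℤ^{mn}` (identified with an `m × n` integer matrix). -/
def Dset (m n : ℕ) (l : Fin m × Fin n → ℤ) : Set (Fin n → ℤ) :=
  {q | ∃ k : Fin m → ℤ, ∀ i j, l (i, j) = k i * q j}

/-- `L(M) = {ℓ ∈ ℤ^{mn} : 0 < |ℓ| ≤ (M/(2 (log₂ M)^{n+1}))^{1/(2mn)}}`. -/
noncomputable def LM (m n : ℕ) (M : ℝ) : Set (Fin m × Fin n → ℤ) :=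
  {l | l ≠ 0 ∧ ‖l‖ ≤ (M / (2 * Real.logb 2 M ^ (n + 1))) ^ ((1 : ℝ) / (2 * m * n))}

/-- `Q'(M) = Q(M) \ ⋃_{ℓ ∈ L(M)} D(ℓ)`. -/
noncomputable def QM' {n : ℕ} (m : ℕ) (Q : Set (Fin n → ℤ)) (Ψ : (Fin n → ℤ) → ℝ) (s M : ℝ) :
    Set (Fin n → ℤ) :=
  QM Q Ψ s M \ ⋃ l ∈ LM m n M, Dset m n l
noncomputable section

/-- The Fourier transform on `ℝ^m`: `φ̂(ξ) = ∫ e^{-2πi x·ξ} φ(x) dx`. -/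
def ftRm {m : ℕ} (φ : (Fin m → ℝ) → ℝ) (ξ : Fin m → ℝ) : ℂ :=
  ∫ x : Fin m → ℝ,
    Complex.exp (((-(2 * Real.pi * ∑ i, x i * ξ i) : ℝ) : ℂ) * Complex.I) * (φ x : ℂ)

/-- The `ℤ^m`-periodization `Φ^ε(y) = ∑_{r ∈ ℤ^m} ε^{-m} φ(ε^{-1}(y - r))`. -/
def PhiEps {m : ℕ} (φ : (Fin m → ℝ) → ℝ) (ε : ℝ) (y : Fin m → ℝ) : ℝ :=
  ∑' r : Fin m → ℤ, (ε ^ m)⁻¹ * φ (fun i => (y i - (r i : ℝ)) / ε)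

/-- `Φ^ε_{q,θ}(x) = Φ^ε(xq - θ)` for `x ∈ ℝ^{mn}` identified with an `m × n` matrix. -/
def PhiQ {m n : ℕ} (φ : (Fin m → ℝ) → ℝ) (ε : ℝ) (q : Fin n → ℤ) (θ : Fin m → ℝ)
    (x : Fin m × Fin n → ℝ) : ℝ :=
  PhiEps φ ε (fun i => (∑ j : Fin n, x (i, j) * (q j : ℝ)) - θ i)

/-- The `ℓ`-th Fourier coefficient `∫_{[0,1]^{mn}} f(x) e^{-2πi ℓ·x} dx` of a
`ℤ^{mn}`-periodic function. -/
def fcoef {m n : ℕ} (f : (Fin m × Fin n → ℝ) → ℝ) (l : Fin m × Fin n → ℤ) : ℂ :=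
  ∫ x in {x : Fin m × Fin n → ℝ | ∀ p, x p ∈ Set.Icc (0 : ℝ) 1},
    (f x : ℂ) * Complex.exp (((-(2 * Real.pi * ∑ p, x p * (l p : ℝ)) : ℝ) : ℂ) * Complex.I)

end
/-- `F_M(x) = |Q'|⁻¹ ∑_{q ∈ Q'} Φ^{Ψ(q)}_{q,θ}(x)`. -/
noncomputable def FM {m n : ℕ} (φ : (Fin m → ℝ) → ℝ) (Ψ : (Fin n → ℤ) → ℝ) (θ : Fin m → ℝ)
    (Q' : Set (Fin n → ℤ)) (x : Fin m × Fin n → ℝ) : ℝ :=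
  ((Q'.ncard : ℝ))⁻¹ * ∑' q : Q', PhiQ φ (Ψ q) q θ x

/-- `w_s(t) = exp(s log t / log log t)`. -/
noncomputable def wfun (s t : ℝ) : ℝ := Real.exp (s * Real.log t / Real.log (Real.log t))

open MeasureTheory

lemma measurePreserving_coe_unitCube (ι : Type*) [Fintype ι] :
    MeasurePreserving (fun (x : ι → ℝ) p => (x p : UnitAddCircle))
      (volume.restrict {x : ι → ℝ | ∀ p, x p ∈ Set.Icc (0 : ℝ) 1}) volume := by
  have hmp : MeasurePreserving (fun (x : ι → ℝ) p => (x p : UnitAddCircle))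
      (Measure.pi fun _ : ι => (volume : Measure ℝ).restrict (Set.Ioc 0 (0 + 1))) volume :=
    measurePreserving_pi _ _ fun _ => UnitAddCircle.measurePreserving_mk 0
  have hset : {x : ι → ℝ | ∀ p, x p ∈ Set.Icc (0 : ℝ) 1} =
      Set.univ.pi fun _ => Set.Icc (0 : ℝ) 1 := by
    ext x; simp only [Set.mem_pi, Set.mem_univ, true_implies, Set.mem_ofPred_eq]
  have hres : (volume : Measure (ι → ℝ)).restrict {x | ∀ p, x p ∈ Set.Icc (0 : ℝ) 1} =
      Measure.pi fun _ : ι => (volume : Measure ℝ).restrict (Set.Ioc 0 (0 + 1)) := by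
    rw [hset, volume_pi, Measure.restrict_pi_pi]
    congr 1
    funext _
    rw [zero_add]
    exact Measure.restrict_congr_set Ioc_ae_eq_Icc.symm
  rwa [hres]

/-- Integrals over the unit torus are integrals over the unit cube. -/
lemma integral_unitCube_comp_coe {ι : Type*} [Fintype ι] (F : (ι → UnitAddCircle) → ℂ)
    (hF : Measurable F) :
    ∫ x in {x : ι → ℝ | ∀ p, x p ∈ Set.Icc (0 : ℝ) 1}, F (fun p => (x p : UnitAddCircle)) =
      ∫ t, F t := by
  have hmp := measurePreserving_coe_unitCube ι
  rw [← hmp.map_eq, integral_map hmp.measurable.aemeasurable hF.aestronglyMeasurable]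

/-- The function on the torus given by evaluation at representatives in `[0,1)`. -/
noncomputable def torusLift {ι : Type*} (g : (ι → ℝ) → ℂ) (t : ι → UnitAddCircle) : ℂ :=
  g fun i => (AddCircle.equivIco (1 : ℝ) 0 (t i) : ℝ)

lemma measurable_torusLift {ι : Type*} {g : (ι → ℝ) → ℂ} (hg : Measurable g) :
    Measurable (torusLift g) := by
  refine hg.comp (measurable_pi_lambda _ fun i => ?_)
  exact measurable_subtype_coe.comp
    ((AddCircle.measurableEquivIco (1 : ℝ) 0).measurable.comp (measurable_pi_apply i))

lemma torusLift_coe {ι : Type*} {g : (ι → ℝ) → ℂ}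
    (hg : ∀ (r : ι → ℤ) x, g (fun i => x i - r i) = g x) (x : ι → ℝ) :
    torusLift g (fun i => (x i : UnitAddCircle)) = g x := by
  rw [← hg (fun i => ⌊x i⌋) x]
  unfold torusLift
  congr 1
  funext i
  have := AddCircle.coe_equivIco_mk_apply (1 : ℝ) (x i)
  simp only [div_one, mul_one] at this
  rw [Int.self_sub_floor]
  exact this

lemma mFourier_coe {ι : Type*} [Fintype ι] (l : ι → ℤ) (x : ι → ℝ) :
    UnitAddTorus.mFourier l (fun p => (x p : UnitAddCircle)) =
      Complex.exp (((2 * Real.pi * ∑ p, x p * (l p : ℝ) : ℝ) : ℂ) * Complex.I) := by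
  simp only [UnitAddTorus.mFourier, ContinuousMap.coe_mk, fourier_coe_apply]
  rw [← Complex.exp_sum]
  congr 1
  push_cast
  rw [Finset.mul_sum, Finset.sum_mul]
  refine Finset.sum_congr rfl fun p _ => ?_
  ring

lemma mFourier_add_apply {ι : Type*} [Fintype ι] (l : ι → ℤ) (x y : ι → UnitAddCircle) :
    UnitAddTorus.mFourier l (x + y) = UnitAddTorus.mFourier l x * UnitAddTorus.mFourier l y := by
  simp only [UnitAddTorus.mFourier, ContinuousMap.coe_mk, Pi.add_apply, ← Finset.prod_mul_distrib]
  refine Finset.prod_congr rfl fun p _ => ?_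
  simp [fourier_apply, smul_add, AddCircle.toCircle_add]

lemma exists_coe_torus {ι : Type*} (t : ι → UnitAddCircle) :
    ∃ x : ι → ℝ, t = fun i => (x i : UnitAddCircle) :=
  ⟨fun i => AddCircle.equivIco (1 : ℝ) 0 (t i), funext fun _ => AddCircle.coe_equivIco.symm⟩

/-- The homomorphism `x ↦ xq` from `m × n` matrices over the circle to vectors. -/
noncomputable def torusMulVec (m : ℕ) {n : ℕ} (q : Fin n → ℤ) :
    (Fin m × Fin n → UnitAddCircle) →+ (Fin m → UnitAddCircle) where
  toFun x i := ∑ j, q j • x (i, j)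
  map_zero' := by ext; simp
  map_add' x y := by ext; simp [smul_add, Finset.sum_add_distrib]

lemma torusMulVec_coe {m n : ℕ} (q : Fin n → ℤ) (x : Fin m × Fin n → ℝ) :
    torusMulVec m q (fun p => (x p : UnitAddCircle)) =
      fun i => ((∑ j, x (i, j) * (q j : ℝ) : ℝ) : UnitAddCircle) := by
  funext i
  change ∑ j, q j • ((x (i, j) : ℝ) : UnitAddCircle) = _
  have h : ∀ y : ℝ, (y : UnitAddCircle) = QuotientAddGroup.mk' _ y := fun _ => rfl
  simp only [h, map_sum]
  refine Finset.sum_congr rfl fun j _ => ?_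
  rw [← map_zsmul, zsmul_eq_mul, mul_comm]

lemma measurePreserving_torusMulVec {m n : ℕ} {q : Fin n → ℤ} (hq : q ≠ 0) :
    MeasurePreserving (torusMulVec m q) volume volume := by
  refine AddMonoidHom.measurePreserving ?_ ?_ ?_
  · refine continuous_pi fun i => ?_
    change Continuous fun x : Fin m × Fin n → UnitAddCircle => ∑ j, q j • x (i, j)
    fun_prop
  · intro t
    obtain ⟨y, rfl⟩ := exists_coe_torus t
    obtain ⟨j₀, hj₀⟩ := Function.ne_iff.mp hq
    have hj : (q j₀ : ℝ) ≠ 0 := by exact_mod_cast hj₀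
    refine ⟨fun p => ((if p.2 = j₀ then y p.1 / q j₀ else 0 : ℝ) : UnitAddCircle), ?_⟩
    rw [torusMulVec_coe]
    funext i
    simp [hj]
  · simp [volume_pi, Measure.pi_univ]

/-- If `q` is not a divisor of `ℓ`, then the character `-ℓ` is nontrivial on the kernel of
`x ↦ xq`. -/
lemma exists_ker_mFourier_ne_one {m n : ℕ} {q : Fin n → ℤ} (hq : q ≠ 0)
    {l : Fin m × Fin n → ℤ} (hl : q ∉ Dset m n l) :
    ∃ t : Fin m × Fin n → UnitAddCircle,
      torusMulVec m q t = 0 ∧ UnitAddTorus.mFourier (-l) t ≠ 1 := by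
  by_contra! hcon
  apply hl
  have key : ∀ x : Fin m × Fin n → ℝ, (∀ i, ∃ a : ℤ, ∑ j, x (i, j) * (q j : ℝ) = a) →
      ∃ b : ℤ, ∑ p, x p * (l p : ℝ) = b := by
    intro x hx
    have h1 := hcon (fun p => (x p : UnitAddCircle)) (by
      rw [torusMulVec_coe]
      funext i
      obtain ⟨a, ha⟩ := hx i
      rw [ha]
      simp)
    rw [mFourier_coe, Complex.exp_eq_one_iff] at h1
    obtain ⟨b, hb⟩ := h1
    refine ⟨-b, ?_⟩
    have h2 : (2 * Real.pi * ∑ p, x p * (((-l) p : ℤ) : ℝ) : ℝ) = 2 * Real.pi * b := by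
      have : (((2 * Real.pi * ∑ p, x p * (((-l) p : ℤ) : ℝ) : ℝ) : ℂ)) * Complex.I =
          ((2 * Real.pi * b : ℝ) : ℂ) * Complex.I := by
        rw [hb]; push_cast; ring
      exact_mod_cast mul_right_cancel₀ Complex.I_ne_zero this
    have h3 := mul_left_cancel₀ (by positivity) h2
    simp only [Pi.neg_apply, Int.cast_neg, mul_neg, Finset.sum_neg_distrib] at h3
    push_cast
    linarith
  obtain ⟨j₀, hj₀⟩ := Function.ne_iff.mp hq
  have hj : (q j₀ : ℝ) ≠ 0 := by exact_mod_cast hj₀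
  have hdiv : ∀ i, ∃ a : ℤ, l (i, j₀) = a * q j₀ := by
    intro i
    obtain ⟨b, hb⟩ := key (fun p => if p = (i, j₀) then (q j₀ : ℝ)⁻¹ else 0) (by
      intro i'
      refine ⟨if i' = i then 1 else 0, ?_⟩
      by_cases h : i' = i <;> simp [Prod.ext_iff, h, hj])
    refine ⟨b, ?_⟩
    simp only [ite_mul, zero_mul, Finset.sum_ite_eq', Finset.mem_univ, if_true] at hb
    field_simp at hb
    rw [mul_comm]
    exact_mod_cast hb
  choose a ha using hdiv
  refine ⟨a, fun i j => ?_⟩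
  by_cases hjj : j = j₀
  · rw [hjj, ha]
  by_contra hne
  set c : ℝ := l (i, j) * q j₀ - l (i, j₀) * q j with hc
  have hc0 : c ≠ 0 := by
    intro h0
    apply hne
    have h1 : l (i, j) * q j₀ - l (i, j₀) * q j = 0 := by
      rw [hc] at h0; exact_mod_cast h0
    rw [ha i] at h1
    exact mul_right_cancel₀ hj₀ (by linarith)
  obtain ⟨b, hb⟩ := key (fun p => (if p = (i, j) then (q j₀ : ℝ) / (2 * c) else 0) -
      if p = (i, j₀) then (q j : ℝ) / (2 * c) else 0) (by
    intro i'
    refine ⟨0, ?_⟩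
    by_cases h : i' = i
    · simp [Prod.ext_iff, h, sub_mul, Finset.sum_sub_distrib]
      ring
    · simp [Prod.ext_iff, h])
  simp only [sub_mul, ite_mul, zero_mul, Finset.sum_sub_distrib, Finset.sum_ite_eq',
    Finset.mem_univ, if_true] at hb
  have h2 : (1 : ℝ) / 2 = b := by
    rw [← hb]
    have : (q j₀ : ℝ) / (2 * c) * l (i, j) - q j / (2 * c) * l (i, j₀) = c / (2 * c) := by
      rw [hc]; ring
    rw [this]; field_simp
  have h3 : (1 : ℤ) = 2 * b := by
    have : (1 : ℝ) = 2 * b := by linarith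
    exact_mod_cast this
  omega

/-- The translates of the unit cube by `ℤ^m` tile `ℝ^m`. -/
lemma iUnion_integer_cubes (m : ℕ) :
    ⋃ r : Fin m → ℤ, {x : Fin m → ℝ | ∀ i, x i + r i ∈ Set.Ico (0 : ℝ) 1} = Set.univ := by
  refine Set.eq_univ_of_forall fun x => Set.mem_iUnion.2 ⟨fun i => -⌊x i⌋, fun i => ?_⟩
  push_cast
  rw [← sub_eq_add_neg, Int.self_sub_floor]
  exact ⟨Int.fract_nonneg _, Int.fract_lt_one _⟩

lemma pairwise_disjoint_integer_cubes (m : ℕ) :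
    Pairwise (Function.onFun Disjoint
      fun r : Fin m → ℤ => {x : Fin m → ℝ | ∀ i, x i + r i ∈ Set.Ico (0 : ℝ) 1}) := by
  intro r r' hr
  refine Set.disjoint_left.2 fun x hx hx' => hr (funext fun i => ?_)
  have h1 := hx i
  have h2 := hx' i
  have h3 : (r i : ℝ) < r' i + 1 := by linarith [h1.2, h2.1]
  have h4 : (r' i : ℝ) < r i + 1 := by linarith [h2.2, h1.1]
  norm_cast at h3 h4
  omega

lemma measurableSet_integer_cube {m : ℕ} (r : Fin m → ℤ) :
    MeasurableSet {x : Fin m → ℝ | ∀ i, x i + r i ∈ Set.Ico (0 : ℝ) 1} := by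
  rw [Set.ofPred_forall]
  exact MeasurableSet.iInter fun i => ((measurable_pi_apply i).add_const _) measurableSet_Ico

lemma unitCube_ae_eq (ι : Type*) [Fintype ι] :
    ({x : ι → ℝ | ∀ i, x i ∈ Set.Icc (0 : ℝ) 1} : Set (ι → ℝ)) =ᵐ[volume]
      {x : ι → ℝ | ∀ i, x i ∈ Set.Ico (0 : ℝ) 1} := by
  have h : ∀ s : Set ℝ, {x : ι → ℝ | ∀ i, x i ∈ s} = Set.univ.pi fun _ => s := by
    intro s; ext x; simp only [Set.mem_pi, Set.mem_univ, true_implies, Set.mem_ofPred_eq]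
  rw [h, h, volume_pi]
  exact (Measure.ae_eq_set_pi fun i _ => Ico_ae_eq_Icc).symm

lemma measurePreserving_sub_restrict_unitCube {m : ℕ} (r : Fin m → ℤ) :
    MeasurePreserving (fun x : Fin m → ℝ => fun i => x i - (r i : ℝ))
      (volume.restrict {x | ∀ i, x i ∈ Set.Icc (0 : ℝ) 1})
      (volume.restrict {x : Fin m → ℝ | ∀ i, x i + r i ∈ Set.Ico (0 : ℝ) 1}) := by
  rw [Measure.restrict_congr_set (unitCube_ae_eq (Fin m))]
  have h := (measurePreserving_sub_right (volume : Measure (Fin m → ℝ))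
    (fun i => (r i : ℝ))).restrict_preimage (measurableSet_integer_cube r)
  have hset : {x : Fin m → ℝ | ∀ i, x i ∈ Set.Ico (0 : ℝ) 1} =
      (fun x => x - fun i => (r i : ℝ)) ⁻¹'
        {x : Fin m → ℝ | ∀ i, x i + r i ∈ Set.Ico (0 : ℝ) 1} := by
    ext x
    simp only [Set.mem_preimage, Set.mem_ofPred_eq, Pi.sub_apply, sub_add_cancel]
  rw [hset]
  exact h

lemma tsum_lintegral_unitCube {m : ℕ} {h : (Fin m → ℝ) → ENNReal} (hh : Measurable h) :
    ∑' r : Fin m → ℤ, ∫⁻ x in {x : Fin m → ℝ | ∀ i, x i ∈ Set.Icc (0 : ℝ) 1},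
      h (fun i => x i - (r i : ℝ)) = ∫⁻ x, h x := by
  rw [← setLIntegral_univ (μ := volume) h, ← iUnion_integer_cubes m,
    lintegral_iUnion measurableSet_integer_cube (pairwise_disjoint_integer_cubes m)]
  exact tsum_congr fun r => (measurePreserving_sub_restrict_unitCube r).lintegral_comp hh

lemma tsum_integral_unitCube {m : ℕ} {h : (Fin m → ℝ) → ℂ} (hh : Integrable h)
    (hm : Measurable h) :
    ∑' r : Fin m → ℤ, ∫ x in {x : Fin m → ℝ | ∀ i, x i ∈ Set.Icc (0 : ℝ) 1},
      h (fun i => x i - (r i : ℝ)) = ∫ x, h x := by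
  rw [← setIntegral_univ (μ := volume) (f := h), ← iUnion_integer_cubes m,
    integral_iUnion measurableSet_integer_cube (pairwise_disjoint_integer_cubes m)
      hh.integrableOn]
  refine tsum_congr fun r => ?_
  have hmp := measurePreserving_sub_restrict_unitCube r
  rw [← hmp.map_eq, integral_map hmp.measurable.aemeasurable hm.aestronglyMeasurable]

lemma measurable_comp_sub_intCast {m : ℕ} {h : (Fin m → ℝ) → ℂ} (hm : Measurable h)
    (r : Fin m → ℤ) : Measurable fun x : Fin m → ℝ => h (fun i => x i - (r i : ℝ)) :=
  hm.comp (by fun_prop)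

lemma tsum_lintegral_enorm_ne_top {m : ℕ} {h : (Fin m → ℝ) → ℂ} (hh : Integrable h)
    (hm : Measurable h) :
    ∑' r : Fin m → ℤ, ∫⁻ x in {x : Fin m → ℝ | ∀ i, x i ∈ Set.Icc (0 : ℝ) 1},
      ‖h (fun i => x i - (r i : ℝ))‖ₑ ≠ ⊤ := by
  rw [tsum_lintegral_unitCube (h := fun x => ‖h x‖ₑ) hm.enorm]
  exact hh.2.ne

/-- Unfolding: the integral of a periodization over the unit cube. -/
lemma integral_unitCube_tsum {m : ℕ} {h : (Fin m → ℝ) → ℂ} (hh : Integrable h)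
    (hm : Measurable h) :
    ∫ x in {x : Fin m → ℝ | ∀ i, x i ∈ Set.Icc (0 : ℝ) 1},
      ∑' r : Fin m → ℤ, h (fun i => x i - (r i : ℝ)) = ∫ x, h x := by
  rw [integral_tsum (fun r => (measurable_comp_sub_intCast hm r).aestronglyMeasurable)
    (tsum_lintegral_enorm_ne_top hh hm), tsum_integral_unitCube hh hm]

lemma measurable_periodization {m : ℕ} {h : (Fin m → ℝ) → ℂ} (hm : Measurable h) :
    Measurable fun x : Fin m → ℝ => ∑' r : Fin m → ℤ, h (fun i => x i - (r i : ℝ)) :=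
  Measurable.tsum fun r => measurable_comp_sub_intCast hm r

lemma integrableOn_periodization {m : ℕ} {h : (Fin m → ℝ) → ℂ} (hh : Integrable h)
    (hm : Measurable h) :
    IntegrableOn (fun x : Fin m → ℝ => ∑' r : Fin m → ℤ, h (fun i => x i - (r i : ℝ)))
      {x : Fin m → ℝ | ∀ i, x i ∈ Set.Icc (0 : ℝ) 1} := by
  refine ⟨(measurable_periodization hm).aestronglyMeasurable, ?_⟩
  refine lt_of_le_of_lt (lintegral_mono fun x => enorm_tsum_le_tsum_enorm) ?_
  rw [lintegral_tsum fun r => (measurable_comp_sub_intCast hm r).enorm.aemeasurable]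
  exact (tsum_lintegral_enorm_ne_top hh hm).lt_top

lemma periodization_periodic {m : ℕ} (h : (Fin m → ℝ) → ℂ) (a : Fin m → ℤ) (x : Fin m → ℝ) :
    ∑' r : Fin m → ℤ, h (fun i => x i - (a i : ℝ) - (r i : ℝ)) =
      ∑' r : Fin m → ℤ, h (fun i => x i - (r i : ℝ)) := by
  rw [← (Equiv.addLeft a).tsum_eq fun r => h (fun i => x i - (r i : ℝ))]
  refine tsum_congr fun r => congrArg h (funext fun i => ?_)
  simp [sub_sub]

/-- The rescaled bump whose periodization is `y ↦ Φ^ε(y - θ)`. -/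
noncomputable def scaledBump {m : ℕ} (φ : (Fin m → ℝ) → ℝ) (ε : ℝ) (θ : Fin m → ℝ)
    (y : Fin m → ℝ) : ℂ :=
  (((ε ^ m)⁻¹ * φ (fun i => (y i - θ i) / ε) : ℝ) : ℂ)

lemma PhiEps_eq_periodization {m : ℕ} (φ : (Fin m → ℝ) → ℝ) (ε : ℝ) (θ y : Fin m → ℝ) :
    (PhiEps φ ε (fun i => y i - θ i) : ℂ) =
      ∑' r : Fin m → ℤ, scaledBump φ ε θ (fun i => y i - (r i : ℝ)) := by
  rw [PhiEps, Complex.ofReal_tsum]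
  refine tsum_congr fun r => ?_
  simp only [scaledBump, sub_right_comm]

lemma measurable_scaledBump {m : ℕ} {φ : (Fin m → ℝ) → ℝ} (hφ : Measurable φ) (ε : ℝ)
    (θ : Fin m → ℝ) : Measurable (scaledBump φ ε θ) := by
  unfold scaledBump
  have h : Measurable fun y : Fin m → ℝ => fun i => (y i - θ i) / ε := by fun_prop
  exact Complex.measurable_ofReal.comp ((hφ.comp h).const_mul _)

lemma integrable_scaledBump {m : ℕ} {φ : (Fin m → ℝ) → ℝ} (hφ : Integrable φ) {ε : ℝ}
    (hε : 0 < ε) (θ : Fin m → ℝ) : Integrable (scaledBump φ ε θ) := by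
  have h1 : Integrable fun x : Fin m → ℝ => φ (ε⁻¹ • x) :=
    hφ.comp_smul (inv_ne_zero hε.ne')
  have h2 := ((h1.comp_sub_right θ).const_mul (ε ^ m)⁻¹).ofReal (𝕜 := ℂ)
  refine h2.congr (Filter.Eventually.of_forall fun y => ?_)
  simp only [scaledBump]
  congr 3
  funext i
  simp [div_eq_inv_mul]

/-- The Fourier transform of a rescaled and translated bump. -/
lemma norm_integral_scaledBump {m : ℕ} (φ : (Fin m → ℝ) → ℝ) {ε : ℝ} (hε : 0 < ε)
    (θ : Fin m → ℝ) (k : Fin m → ℤ) :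
    ‖∫ y, scaledBump φ ε θ y *
        Complex.exp (((-(2 * Real.pi * ∑ i, y i * (k i : ℝ)) : ℝ) : ℂ) * Complex.I)‖ =
      ‖ftRm φ (fun i => ε * (k i : ℝ))‖ := by
  set E : (Fin m → ℝ) → ℂ := fun y =>
    Complex.exp (((-(2 * Real.pi * ∑ i, y i * (k i : ℝ)) : ℝ) : ℂ) * Complex.I)
  set G : (Fin m → ℝ) → ℂ := fun z => (((ε ^ m)⁻¹ : ℝ) : ℂ) * (φ z : ℂ) * E (fun i => ε * z i + θ i)
  have h1 : ∀ y, scaledBump φ ε θ y * E y = G (ε⁻¹ • (y - θ)) := by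
    intro y
    simp only [scaledBump, G]
    have e1 : (fun i => (y i - θ i) / ε) = ε⁻¹ • (y - θ) := by
      funext i; simp [div_eq_inv_mul]
    have e2 : (fun i => ε * (ε⁻¹ • (y - θ)) i + θ i) = y := by
      funext i; simp [hε.ne']
    rw [e1, e2]
    push_cast
    rfl
  have h2 : ∀ z, G z = ((((ε ^ m)⁻¹ : ℝ) : ℂ) * E θ) *
      (Complex.exp (((-(2 * Real.pi * ∑ i, z i * (ε * (k i : ℝ))) : ℝ) : ℂ) * Complex.I) *
        (φ z : ℂ)) := by
    intro z
    have : E (fun i => ε * z i + θ i) = E θ *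
        Complex.exp (((-(2 * Real.pi * ∑ i, z i * (ε * (k i : ℝ))) : ℝ) : ℂ) * Complex.I) := by
      simp only [E]
      rw [← Complex.exp_add, ← add_mul, ← Complex.ofReal_add]
      congr 3
      simp only [add_mul, Finset.sum_add_distrib]
      have : ∑ i, ε * z i * (k i : ℝ) = ∑ i, z i * (ε * (k i : ℝ)) :=
        Finset.sum_congr rfl fun i _ => by ring
      rw [this]; ring
    simp only [G]
    rw [this]; ring
  have hE : ‖E θ‖ = 1 := Complex.norm_exp_ofReal_mul_I _
  change ‖∫ y, scaledBump φ ε θ y * E y‖ = _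
  simp_rw [h1]
  rw [integral_sub_right_eq_self (fun y => G (ε⁻¹ • y)) θ, Measure.integral_comp_inv_smul]
  simp_rw [h2]
  rw [integral_const_mul, norm_smul, norm_mul, norm_mul, hE]
  have : ‖|ε ^ Module.finrank ℝ (Fin m → ℝ)|‖ * ‖(((ε ^ m)⁻¹ : ℝ) : ℂ)‖ = 1 := by
    rw [Complex.norm_real, ← norm_abs_eq_norm ((ε ^ m)⁻¹)]
    simp [hε.ne']
  rw [mul_one, ← mul_assoc, this, one_mul]
  rfl

/-- `y ↦ Φ^ε(y - θ)` as a complex function on the torus. -/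
noncomputable def torusPhi {m : ℕ} (φ : (Fin m → ℝ) → ℝ) (ε : ℝ) (θ : Fin m → ℝ) :
    (Fin m → UnitAddCircle) → ℂ :=
  torusLift fun y => (PhiEps φ ε (fun i => y i - θ i) : ℂ)

lemma measurable_torusPhi {m : ℕ} {φ : (Fin m → ℝ) → ℝ} (hφ : Measurable φ) (ε : ℝ)
    (θ : Fin m → ℝ) : Measurable (torusPhi φ ε θ) := by
  refine measurable_torusLift ?_
  simp_rw [PhiEps_eq_periodization]
  exact measurable_periodization (measurable_scaledBump hφ ε θ)

lemma torusPhi_coe {m : ℕ} (φ : (Fin m → ℝ) → ℝ) (ε : ℝ) (θ y : Fin m → ℝ) :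
    torusPhi φ ε θ (fun i => (y i : UnitAddCircle)) = PhiEps φ ε (fun i => y i - θ i) := by
  refine torusLift_coe (fun r x => ?_) y
  rw [PhiEps_eq_periodization, PhiEps_eq_periodization, periodization_periodic]

lemma torusPhi_mulVec_coe {m n : ℕ} (φ : (Fin m → ℝ) → ℝ) (ε : ℝ) (q : Fin n → ℤ)
    (θ : Fin m → ℝ) (x : Fin m × Fin n → ℝ) :
    torusPhi φ ε θ (torusMulVec m q (fun p => (x p : UnitAddCircle))) = PhiQ φ ε q θ x := by
  rw [torusMulVec_coe, torusPhi_coe, PhiQ]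

lemma exp_neg_eq_mFourier {ι : Type*} [Fintype ι] (l : ι → ℤ) (x : ι → ℝ) :
    Complex.exp (((-(2 * Real.pi * ∑ p, x p * (l p : ℝ)) : ℝ) : ℂ) * Complex.I) =
      UnitAddTorus.mFourier (-l) (fun p => (x p : UnitAddCircle)) := by
  rw [mFourier_coe]
  simp

lemma fcoef_PhiQ_eq_torus {m n : ℕ} {φ : (Fin m → ℝ) → ℝ} (hφ : Measurable φ) (ε : ℝ)
    {q : Fin n → ℤ} (hq : q ≠ 0) (θ : Fin m → ℝ) (l : Fin m × Fin n → ℤ) :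
    fcoef (PhiQ φ ε q θ) l = ∫ t : Fin m × Fin n → UnitAddCircle,
      torusPhi φ ε θ (torusMulVec m q t) * UnitAddTorus.mFourier (-l) t := by
  rw [← integral_unitCube_comp_coe, fcoef]
  · simp_rw [torusPhi_mulVec_coe, exp_neg_eq_mFourier]
  · exact ((measurable_torusPhi hφ ε θ).comp (measurePreserving_torusMulVec hq).measurable).mul
      (UnitAddTorus.mFourier (-l)).continuous.measurable

lemma fcoef_PhiQ_eq_zero {m n : ℕ} {φ : (Fin m → ℝ) → ℝ} (hφ : Measurable φ) (ε : ℝ)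
    {q : Fin n → ℤ} (hq : q ≠ 0) (θ : Fin m → ℝ) {l : Fin m × Fin n → ℤ}
    (hl : q ∉ Dset m n l) : fcoef (PhiQ φ ε q θ) l = 0 := by
  obtain ⟨t₀, h0, h1⟩ := exists_ker_mFourier_ne_one hq hl
  rw [fcoef_PhiQ_eq_torus hφ ε hq]
  set I := ∫ t : Fin m × Fin n → UnitAddCircle,
      torusPhi φ ε θ (torusMulVec m q t) * UnitAddTorus.mFourier (-l) t with hI
  have h : I = I * UnitAddTorus.mFourier (-l) t₀ := by
    conv_lhs => rw [hI, ← integral_add_right_eq_self _ t₀]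
    simp_rw [map_add, h0, add_zero, mFourier_add_apply, ← mul_assoc]
    rw [integral_mul_const]
  by_contra hne
  exact h1 (mul_left_cancel₀ hne (by rw [← h, mul_one]))

lemma mFourier_torusMulVec {m n : ℕ} (q : Fin n → ℤ) {k : Fin m → ℤ}
    {l : Fin m × Fin n → ℤ} (hl : ∀ i j, l (i, j) = k i * q j)
    (t : Fin m × Fin n → UnitAddCircle) :
    UnitAddTorus.mFourier (-l) t = UnitAddTorus.mFourier (-k) (torusMulVec m q t) := by
  obtain ⟨x, rfl⟩ := exists_coe_torus t
  rw [torusMulVec_coe, mFourier_coe, mFourier_coe, Fintype.sum_prod_type]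
  congr 4
  refine Finset.sum_congr rfl fun i _ => ?_
  rw [Finset.sum_mul]
  refine Finset.sum_congr rfl fun j _ => ?_
  rw [Pi.neg_apply, hl, Pi.neg_apply]
  push_cast
  ring

lemma norm_fcoef_PhiQ {m n : ℕ} {φ : (Fin m → ℝ) → ℝ} (hφ : Measurable φ)
    (hφi : Integrable φ) {ε : ℝ} (hε : 0 < ε) {q : Fin n → ℤ} (hq : q ≠ 0) (θ : Fin m → ℝ)
    {k : Fin m → ℤ} {l : Fin m × Fin n → ℤ} (hl : ∀ i j, l (i, j) = k i * q j) :
    ‖fcoef (PhiQ φ ε q θ) l‖ = ‖ftRm φ (fun i => ε * (k i : ℝ))‖ := by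
  have hmF : Measurable fun u : Fin m → UnitAddCircle =>
      torusPhi φ ε θ u * UnitAddTorus.mFourier (-k) u :=
    (measurable_torusPhi hφ ε θ).mul (UnitAddTorus.mFourier (-k)).continuous.measurable
  have hmp := measurePreserving_torusMulVec (m := m) hq
  rw [fcoef_PhiQ_eq_torus hφ ε hq]
  simp_rw [mFourier_torusMulVec q hl]
  rw [← integral_map (f := fun u => torusPhi φ ε θ u * UnitAddTorus.mFourier (-k) u)
    hmp.measurable.aemeasurable hmF.aestronglyMeasurable, hmp.map_eq,
    ← integral_unitCube_comp_coe _ hmF]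
  simp_rw [torusPhi_coe, PhiEps_eq_periodization]
  set E : (Fin m → ℝ) → ℂ := fun y =>
    UnitAddTorus.mFourier (-k) (fun p => (y p : UnitAddCircle)) with hE
  have hEm : Measurable E :=
    (UnitAddTorus.mFourier (-k)).continuous.measurable.comp
      (measurable_pi_lambda _ fun i => AddCircle.measurable_mk'.comp (measurable_pi_apply i))
  have hEper : ∀ (r : Fin m → ℤ) y, E (fun i => y i - (r i : ℝ)) = E y := by
    intro r y
    simp only [hE]
    congr 1
    funext i
    simp
  have hEn : ∀ y, ‖E y‖ ≤ 1 := fun y => by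
    simp only [hE]
    rw [← exp_neg_eq_mFourier, Complex.norm_exp_ofReal_mul_I]
  have hint : Integrable fun y => scaledBump φ ε θ y * E y :=
    (integrable_scaledBump hφi hε θ).mul_bdd (c := 1) hEm.aestronglyMeasurable
      (Filter.Eventually.of_forall hEn)
  have hunf := integral_unitCube_tsum hint ((measurable_scaledBump hφ ε θ).mul hEm)
  simp_rw [hEper, tsum_mul_right] at hunf
  rw [hunf, ← norm_integral_scaledBump φ hε θ k]
  simp_rw [exp_neg_eq_mFourier]
  rfl

lemma integrableOn_PhiQ {m n : ℕ} {φ : (Fin m → ℝ) → ℝ} (hφ : Measurable φ)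
    (hφi : Integrable φ) {ε : ℝ} (hε : 0 < ε) {q : Fin n → ℤ} (hq : q ≠ 0) (θ : Fin m → ℝ) :
    IntegrableOn (fun x => (PhiQ φ ε q θ x : ℂ))
      {x : Fin m × Fin n → ℝ | ∀ p, x p ∈ Set.Icc (0 : ℝ) 1} := by
  have hm := measurable_torusPhi hφ ε θ
  have hcube : Integrable (torusPhi φ ε θ) := by
    rw [← (measurePreserving_coe_unitCube (Fin m)).integrable_comp hm.aestronglyMeasurable]
    refine (integrableOn_periodization (integrable_scaledBump hφi hε θ)
      (measurable_scaledBump hφ ε θ)).congr (Filter.Eventually.of_forall fun y => ?_)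
    simp only [Function.comp_apply, torusPhi_coe, PhiEps_eq_periodization]
  have hmp := (measurePreserving_torusMulVec (m := m) hq).comp
    (measurePreserving_coe_unitCube (Fin m × Fin n))
  refine ((hmp.integrable_comp hm.aestronglyMeasurable).2 hcube).congr
    (Filter.Eventually.of_forall fun x => ?_)
  simp only [Function.comp_apply, torusPhi_mulVec_coe]

/-- Divisor bound with a free parameter `α`. -/
lemma card_divisors_le_rpow_mul_exp {N : ℕ} (hN : N ≠ 0) {α : ℝ} (hα : 0 < α) :
    (N.divisors.card : ℝ) ≤
      (N : ℝ) ^ α * Real.exp ((2 : ℝ) ^ (1 / α) * (1 / (α * Real.log 2))) := by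
  have hlog2 : 0 < Real.log 2 := Real.log_pos one_lt_two
  set c : ℝ := 1 / (α * Real.log 2) with hc
  have hc0 : 0 < c := by positivity
  set X : ℝ := (2 : ℝ) ^ (1 / α) with hX
  have hX0 : 0 < X := by positivity
  have hlocal : ∀ p ∈ N.primeFactors, ((N.factorization p + 1 : ℕ) : ℝ) ≤
      ((p : ℝ) ^ N.factorization p) ^ α * (if (p : ℝ) ≤ X then Real.exp c else 1) := by
    intro p hp
    have hp2 : (2 : ℝ) ≤ p := by exact_mod_cast (Nat.prime_of_mem_primeFactors hp).two_le
    set a := N.factorization p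
    have hpa : ((p : ℝ) ^ a) ^ α = ((p : ℝ) ^ α) ^ a := by
      rw [← Real.rpow_natCast, ← Real.rpow_mul (by positivity), mul_comm,
        Real.rpow_mul (by positivity), Real.rpow_natCast]
    split_ifs with hpX
    · have h1 : ((2 : ℝ) ^ a) ^ α ≤ ((p : ℝ) ^ a) ^ α := by gcongr
      have h2 : ((2 : ℝ) ^ a) ^ α = Real.exp (a * (α * Real.log 2)) := by
        rw [← Real.rpow_natCast, ← Real.rpow_mul (by positivity),
          Real.rpow_def_of_pos (by positivity)]
        congr 1; ring
      have h3 : 1 + a * (α * Real.log 2) ≤ Real.exp (a * (α * Real.log 2)) := by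
        linarith [Real.add_one_le_exp (a * (α * Real.log 2))]
      have h4 : 1 + c ≤ Real.exp c := by linarith [Real.add_one_le_exp c]
      have h5 : (a : ℝ) = a * (α * Real.log 2) * c := by
        rw [hc]; field_simp
      have h6 : (0 : ℝ) ≤ a * (α * Real.log 2) := by positivity
      push_cast
      calc (a : ℝ) + 1 ≤ (1 + a * (α * Real.log 2)) * (1 + c) := by nlinarith
        _ ≤ ((p : ℝ) ^ a) ^ α * Real.exp c := by
            apply mul_le_mul (by linarith) h4 (by positivity) (by positivity)
    · have h1 : (2 : ℝ) ≤ (p : ℝ) ^ α := by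
        calc (2 : ℝ) = X ^ α := by
              rw [hX, ← Real.rpow_mul (by positivity), one_div_mul_cancel hα.ne', Real.rpow_one]
          _ ≤ (p : ℝ) ^ α := by gcongr; exact (not_le.1 hpX).le
      rw [mul_one, hpa]
      calc ((a + 1 : ℕ) : ℝ) ≤ ((2 ^ a : ℕ) : ℝ) := by exact_mod_cast Nat.lt_two_pow_self
        _ ≤ ((p : ℝ) ^ α) ^ a := by push_cast; gcongr
  rw [Nat.card_divisors hN]
  push_cast
  have hprodN : ∏ p ∈ N.primeFactors, ((p : ℝ) ^ N.factorization p) ^ α = (N : ℝ) ^ α := by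
    rw [Real.finsetProd_rpow _ _ fun p _ => by positivity]
    congr 1
    exact_mod_cast Nat.prod_factorization_pow_eq_self hN
  have hprodE : ∏ p ∈ N.primeFactors, (if (p : ℝ) ≤ X then Real.exp c else 1) ≤
      Real.exp (X * c) := by
    rw [Finset.prod_ite, Finset.prod_const, Finset.prod_const_one, mul_one, ← Real.exp_nat_mul]
    gcongr
    have hsub : N.primeFactors.filter (fun p : ℕ => (p : ℝ) ≤ X) ⊆ Finset.Icc 1 ⌊X⌋₊ := by
      intro p hp
      rw [Finset.mem_filter] at hp
      exact Finset.mem_Icc.2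
        ⟨(Nat.prime_of_mem_primeFactors hp.1).one_le, Nat.le_floor hp.2⟩
    calc ((N.primeFactors.filter (fun p : ℕ => (p : ℝ) ≤ X)).card : ℝ)
        ≤ ((Finset.Icc 1 ⌊X⌋₊).card : ℝ) := by exact_mod_cast Finset.card_le_card hsub
      _ ≤ X := by simpa using Nat.floor_le hX0.le
  calc ∏ p ∈ N.primeFactors, ((N.factorization p : ℝ) + 1)
      ≤ ∏ p ∈ N.primeFactors, (((p : ℝ) ^ N.factorization p) ^ α *
          (if (p : ℝ) ≤ X then Real.exp c else 1)) :=
        Finset.prod_le_prod (fun p _ => by positivity) fun p hp => by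
          exact_mod_cast hlocal p hp
    _ ≤ _ := by
        rw [Finset.prod_mul_distrib, hprodN]
        gcongr

lemma eventually_rpow_mul_log_le {β c δ : ℝ} (hβ : β < 1) (hδ : 0 < δ) :
    ∀ᶠ L : ℝ in Filter.atTop, L ^ β * (Real.log L * c) ≤ δ * L / Real.log L := by
  have h1 : (fun L : ℝ => Real.log L ^ (2 : ℝ)) =o[Filter.atTop] fun L => L ^ (1 - β) :=
    isLittleO_log_rpow_rpow_atTop 2 (by linarith)
  have h2 := h1.bound (c := δ / (|c| + 1)) (by positivity)
  filter_upwards [h2, Filter.eventually_gt_atTop (1 : ℝ)] with L hL hL1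
  have hlog : 0 < Real.log L := Real.log_pos hL1
  have hL0 : 0 < L := by linarith
  rw [Real.norm_of_nonneg (by positivity), Real.norm_of_nonneg (by positivity)] at hL
  norm_cast at hL
  rw [le_div_iff₀ hlog]
  have h3 : L ^ β * L ^ (1 - β) = L := by
    rw [← Real.rpow_add hL0]; simp
  have hc : c ≤ |c| + 1 := by linarith [le_abs_self c]
  calc L ^ β * (Real.log L * c) * Real.log L = L ^ β * (c * Real.log L ^ 2) := by ring
    _ ≤ L ^ β * ((|c| + 1) * (δ / (|c| + 1) * L ^ (1 - β))) := by gcongr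
    _ = δ * (L ^ β * L ^ (1 - β)) := by field_simp
    _ = δ * L := by rw [h3]

lemma log_log_pos {N : ℝ} (hN : 3 ≤ N) : 0 < Real.log (Real.log N) := by
  refine Real.log_pos ((Real.lt_log_iff_exp_lt (by linarith)).2 ?_)
  linarith [Real.exp_one_lt_d9]

/-- Wigert's bound for the number of divisors. -/
lemma exists_card_divisors_le_wfun {ζ : ℝ} (hζ : Real.log 2 < ζ) :
    ∃ A : ℝ, 0 < A ∧ ∀ N : ℕ, 3 ≤ N → (N.divisors.card : ℝ) ≤ A * wfun ζ N := by
  have hlog2 : 0 < Real.log 2 := Real.log_pos one_lt_two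
  obtain ⟨η, hη, hηζ⟩ := exists_between hζ
  have hη0 : 0 < η := hlog2.trans hη
  have hev := (eventually_rpow_mul_log_le (β := Real.log 2 / η) (c := 1 / (η * Real.log 2))
    ((div_lt_one hη0).2 hη) (sub_pos.2 hηζ))
  obtain ⟨N₀, hN₀⟩ := Filter.eventually_atTop.1
    ((Real.tendsto_log_atTop.comp tendsto_natCast_atTop_atTop).eventually hev)
  refine ⟨N₀ + 1, by positivity, fun N hN => ?_⟩
  have hN3 : (3 : ℝ) ≤ N := by exact_mod_cast hN
  have hLL : 0 < Real.log (Real.log N) := log_log_pos hN3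
  have hL : 0 < Real.log N := Real.log_pos (by linarith)
  have hw : 1 ≤ wfun ζ N := by
    refine Real.one_le_exp ?_
    have : 0 < ζ := hlog2.trans hζ
    positivity
  rcases lt_or_ge N N₀ with h | h
  · have h1 : (N.divisors.card : ℝ) ≤ N := by exact_mod_cast Nat.card_divisors_le_self N
    have h2 : (N : ℝ) ≤ N₀ := by exact_mod_cast h.le
    nlinarith [(Nat.cast_nonneg N₀ : (0 : ℝ) ≤ N₀)]
  · have h1 := hN₀ N h
    simp only [Function.comp_apply] at h1
    have h2 : (N.divisors.card : ℝ) ≤ wfun ζ N := by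
      refine (card_divisors_le_rpow_mul_exp (by omega)
        (div_pos hη0 hLL : 0 < η / Real.log (Real.log N))).trans ?_
      rw [Real.rpow_def_of_pos (by linarith), ← Real.exp_add, wfun]
      refine Real.exp_le_exp.2 ?_
      have e1 : (2 : ℝ) ^ (1 / (η / Real.log (Real.log N))) =
          Real.log N ^ (Real.log 2 / η) := by
        rw [Real.rpow_def_of_pos two_pos, Real.rpow_def_of_pos hL]
        congr 1
        field_simp
      have e2 : 1 / (η / Real.log (Real.log N) * Real.log 2) =
          Real.log (Real.log N) * (1 / (η * Real.log 2)) := by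
        field_simp
      rw [e1, e2]
      calc _ ≤ Real.log N * (η / Real.log (Real.log N)) +
              (ζ - η) * Real.log N / Real.log (Real.log N) := by linarith
        _ = _ := by field_simp; ring
    nlinarith [(Nat.cast_nonneg N₀ : (0 : ℝ) ≤ N₀)]

lemma exists_norm_eq_natAbs {ι : Type*} [Fintype ι] {l : ι → ℤ} (hl : 0 < ‖l‖) :
    ∃ p, ‖l‖ = ((l p).natAbs : ℝ) := by
  have hne : Nonempty ι := by
    by_contra h
    rw [not_nonempty_iff] at h
    simp [Subsingleton.elim l 0] at hl
  obtain ⟨p, hp⟩ := Finite.exists_max fun p => ‖l p‖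
  refine ⟨p, ?_⟩
  rw [le_antisymm ((pi_norm_le_iff_of_nonempty l).2 hp) (norm_le_pi_norm l p), Nat.cast_natAbs,
    Int.norm_eq_abs, Int.cast_abs]

lemma card_le_two_mul_card_divisors {m n : ℕ} {l : Fin m × Fin n → ℤ} {p : Fin m × Fin n}
    (hp : l p ≠ 0) {T : Finset (Fin n → ℤ)} (hT : ∀ q ∈ T, q ∈ Dset m n l) :
    T.card ≤ 2 * (l p).natAbs.divisors.card := by
  classical
  obtain ⟨i, j⟩ := p
  set S : Finset ℤ := (l (i, j)).natAbs.divisors.image (fun d : ℕ => (d : ℤ)) ∪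
    (l (i, j)).natAbs.divisors.image (fun d : ℕ => -(d : ℤ))
  have hS : S.card ≤ 2 * (l (i, j)).natAbs.divisors.card :=
    (Finset.card_union_le _ _).trans
      ((add_le_add Finset.card_image_le Finset.card_image_le).trans_eq (two_mul _).symm)
  refine (Finset.card_le_card_of_injOn (fun q => q j) ?_ ?_).trans hS
  · intro q hq
    obtain ⟨k, hk⟩ := hT q hq
    have hd : (q j).natAbs ∈ (l (i, j)).natAbs.divisors :=
      Nat.mem_divisors.2 ⟨Int.natAbs_dvd_natAbs.2 ⟨k i, by rw [hk, mul_comm]⟩,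
        Int.natAbs_ne_zero.2 hp⟩
    rw [Finset.mem_coe, Finset.mem_union, Finset.mem_image, Finset.mem_image]
    rcases Int.natAbs_eq (q j) with h | h
    · exact Or.inl ⟨_, hd, h.symm⟩
    · exact Or.inr ⟨_, hd, h.symm⟩
  · intro q hq q' hq' hqq
    obtain ⟨k, hk⟩ := hT q hq
    obtain ⟨k', hk'⟩ := hT q' hq'
    simp only at hqq
    have hne := hp
    rw [hk] at hne
    have hkk : k i = k' i := by
      refine mul_right_cancel₀ (right_ne_zero_of_mul hne) ?_
      rw [← hk, hk', hqq]
    funext j'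
    refine mul_left_cancel₀ (left_ne_zero_of_mul hne) ?_
    rw [← hk, hk', hkk]

/-- The zero vector is never in `Q(M)`. -/
lemma ne_zero_of_mem_QM {n : ℕ} {Q : Set (Fin n → ℤ)} {Ψ : (Fin n → ℤ) → ℝ} {s M : ℝ}
    (hs : 0 < s) (hM : 0 < M) {q : Fin n → ℤ} (hq : q ∈ QM Q Ψ s M) : q ≠ 0 := by
  rintro rfl
  have h := hq.2.1
  rw [PsiStar, norm_zero, div_zero, Real.zero_rpow (neg_ne_zero.2 hs.ne')] at h
  linarith

lemma one_le_norm_of_ne_zero {n : ℕ} {q : Fin n → ℤ} (hq : q ≠ 0) : 1 ≤ ‖q‖ := by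
  obtain ⟨j, hj⟩ := Function.ne_iff.mp hq
  refine le_trans ?_ (norm_le_pi_norm q j)
  rw [Int.norm_eq_abs]
  exact_mod_cast Int.one_le_abs hj

lemma QM_one_eq_empty {n : ℕ} (Q : Set (Fin n → ℤ)) {Ψ : (Fin n → ℤ) → ℝ}
    (hΨ : ∀ q, Ψ q ∈ Set.Ioc (0 : ℝ) (1 / 2)) {s : ℝ} (hs : 0 < s) : QM Q Ψ s 1 = ∅ := by
  refine Set.eq_empty_of_forall_notMem fun q hq => ?_
  have h1 := one_le_norm_of_ne_zero (ne_zero_of_mem_QM hs one_pos hq)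
  have h2 : PsiStar Ψ q < 1 := by
    rw [PsiStar, div_lt_one (by linarith)]
    linarith [(hΨ q).2]
  have h3 : 0 < PsiStar Ψ q := div_pos (hΨ q).1 (by linarith)
  exact absurd hq.2.2 (not_le.2 (Real.one_lt_rpow_of_pos_of_lt_one_of_neg h3 h2 (by linarith)))

/-- Decay of the Fourier coefficient contributed by a single divisor `q ∈ Q(M)` of `ℓ`. -/
lemma norm_ftRm_le {m n : ℕ} {Q : Set (Fin n → ℤ)} {Ψ : (Fin n → ℤ) → ℝ}
    (hΨ : ∀ q, Ψ q ∈ Set.Ioc (0 : ℝ) (1 / 2)) {s : ℝ} (hs : 0 < s)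
    {φ : (Fin m → ℝ) → ℝ} {K : ℕ} (hK : s ≤ K) {C : ℝ} (hC : 0 ≤ C)
    (hdecay : ∀ ξ : Fin m → ℝ, ‖ftRm φ ξ‖ ≤ C * (1 + ‖ξ‖) ^ (-(K : ℝ)))
    {M : ℝ} (hM : 0 < M) {q : Fin n → ℤ} (hq : q ∈ QM Q Ψ s M)
    {l : Fin m × Fin n → ℤ} (hl0 : 0 < ‖l‖) {k : Fin m → ℤ} (hl : ∀ i j, l (i, j) = k i * q j) :
    ‖ftRm φ (fun i => Ψ q * (k i : ℝ))‖ ≤ C * (M * ‖l‖ ^ (-s)) := by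
  have hqn : 0 < ‖q‖ := by linarith [one_le_norm_of_ne_zero (ne_zero_of_mem_QM hs hM hq)]
  have hΨ0 := (hΨ q).1
  set ξ : Fin m → ℝ := fun i => Ψ q * (k i : ℝ)
  have h3 : 0 < PsiStar Ψ q := div_pos hΨ0 hqn
  have hle : ‖l‖ ≤ ‖ξ‖ * ‖q‖ / Ψ q := by
    refine (pi_norm_le_iff_of_nonneg (by positivity)).2 fun p => ?_
    rw [le_div_iff₀ hΨ0]
    have e : ‖l p‖ * Ψ q = ‖ξ p.1‖ * ‖q p.2‖ := by
      rw [show l p = k p.1 * q p.2 from hl p.1 p.2]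
      simp only [ξ, norm_mul, Real.norm_of_nonneg hΨ0.le, Int.norm_eq_abs,
        Real.norm_eq_abs]
      ring
    rw [e]
    exact mul_le_mul (norm_le_pi_norm ξ _) (norm_le_pi_norm q _) (norm_nonneg _) (norm_nonneg _)
  have hx : PsiStar Ψ q * ‖l‖ ≤ ‖ξ‖ := by
    rw [le_div_iff₀ hΨ0] at hle
    rw [PsiStar, div_mul_eq_mul_div, div_le_iff₀ hqn]
    linarith
  refine (hdecay ξ).trans ?_
  gcongr
  calc (1 + ‖ξ‖) ^ (-(K : ℝ)) ≤ (1 + ‖ξ‖) ^ (-s) :=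
        Real.rpow_le_rpow_of_exponent_le (by linarith [norm_nonneg ξ]) (by linarith)
    _ ≤ (PsiStar Ψ q * ‖l‖) ^ (-s) :=
        Real.rpow_le_rpow_of_nonpos (by positivity) (by linarith) (by linarith)
    _ = PsiStar Ψ q ^ (-s) * ‖l‖ ^ (-s) := Real.mul_rpow h3.le hl0.le
    _ ≤ M * ‖l‖ ^ (-s) := by gcongr; exact hq.2.2

lemma fcoef_FM_finset {m n : ℕ} {φ : (Fin m → ℝ) → ℝ} (hφ : Measurable φ)
    (hφi : Integrable φ) {Ψ : (Fin n → ℤ) → ℝ} (hΨ : ∀ q, 0 < Ψ q) (θ : Fin m → ℝ)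
    {T : Finset (Fin n → ℤ)} (hT : ∀ q ∈ T, q ≠ 0) (l : Fin m × Fin n → ℤ) :
    fcoef (FM φ Ψ θ (T : Set (Fin n → ℤ))) l =
      (T.card : ℂ)⁻¹ * ∑ q ∈ T, fcoef (PhiQ φ (Ψ q) q θ) l := by
  simp only [fcoef]
  rw [← integral_finsetSum, ← integral_const_mul]
  · congr 1
    funext x
    rw [FM, Finset.tsum_subtype' T fun q => PhiQ φ (Ψ q) q θ x, Set.ncard_coe_finset,
      ← Finset.sum_mul]
    push_cast
    ring
  · intro q hq
    refine (integrableOn_PhiQ hφ hφi (hΨ q) (hT q hq) θ).mul_bdd (c := 1) ?_ ?_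
    · exact (by fun_prop : Continuous fun x : Fin m × Fin n → ℝ =>
        Complex.exp (((-(2 * Real.pi * ∑ p, x p * (l p : ℝ)) : ℝ) : ℂ) *
          Complex.I)).aestronglyMeasurable
    · exact Filter.Eventually.of_forall fun x => (Complex.norm_exp_ofReal_mul_I _).le

/-- Decay of the Fourier coefficients of `F_M`: if `M₀` is as in the lower bound
`|Q'(M)| ≥ M/(4 (log₂ M)^{n+1})` for `M ∈ 𝓜`, `M ≥ M₀`, then for every `ζ > log 2` there is a
constant `C_ζ` with `|F̂_M(ℓ)| ≤ C_ζ |ℓ|^{-s} w_ζ(|ℓ|) (log M)^{n+1}` for all such `M` and all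
`ℓ` with `|ℓ| ≥ 3`. -/
theorem FM_fourierCoeff_decay (m n : ℕ) (Q : Set (Fin n → ℤ)) (Ψ : (Fin n → ℤ) → ℝ)
    (hΨ : ∀ q, Ψ q ∈ Set.Ioc (0 : ℝ) (1 / 2)) (θ : Fin m → ℝ)
    (s : ℝ) (hs : 0 < s) (hss : s < sExp Q Ψ)
    (φ : (Fin m → ℝ) → ℝ) (hφ0 : ∀ x, 0 ≤ φ x) (hmeas : Measurable φ)
    (hsupp : Function.support φ ⊆ {x | ∀ i, x i ∈ Set.Ioo (-1 : ℝ) 1})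
    (hint : ∫ x : Fin m → ℝ, φ x = 1)
    (K : ℕ) (hK : (m * n : ℝ) + s < K) (C : ℝ)
    (hdecay : ∀ ξ : Fin m → ℝ, ‖ftRm φ ξ‖ ≤ C * (1 + ‖ξ‖) ^ (-(K : ℝ)))
    (M₀ : ℝ)
    (hM₀ : ∀ M ∈ Mcal Q Ψ s, M₀ ≤ M →
      M / (4 * Real.logb 2 M ^ (n + 1)) ≤ ((QM' m Q Ψ s M).ncard : ℝ))
    (ζ : ℝ) (hζ : Real.log 2 < ζ) :
    ∃ Cζ : ℝ, ∀ M ∈ Mcal Q Ψ s, M₀ ≤ M → ∀ l : Fin m × Fin n → ℤ, 3 ≤ ‖l‖ →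
      ‖fcoef (FM φ Ψ θ (QM' m Q Ψ s M)) l‖ ≤
        Cζ * ‖l‖ ^ (-s) * wfun ζ ‖l‖ * Real.log M ^ (n + 1) := by
  classical
  have hφi : Integrable φ := by
    by_contra h
    rw [integral_undef h] at hint
    exact zero_ne_one hint
  have hC : 0 ≤ C := by
    have h := (norm_nonneg _).trans (hdecay 0)
    simpa using h
  have hKs : s ≤ K := by
    have : (0 : ℝ) ≤ m * n := by positivity
    linarith
  have hlog2 : 0 < Real.log 2 := Real.log_pos one_lt_two
  obtain ⟨A, hA, hdiv⟩ := exists_card_divisors_le_wfun hζ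
  refine ⟨8 * A * C / Real.log 2 ^ (n + 1), fun M hMc hM l hl => ?_⟩
  have hcard := hM₀ M hMc hM
  obtain ⟨k, rfl, -⟩ := hMc
  rcases Nat.eq_zero_or_pos k with rfl | hk
  · have hempty : QM' m Q Ψ s (2 ^ 0) = ∅ := by
      rw [QM', pow_zero, QM_one_eq_empty Q hΨ hs, Set.empty_sdiff]
    rw [hempty]
    simp [fcoef, FM]
  set M : ℝ := 2 ^ k with hMdef
  have hM1 : 1 < M := one_lt_pow₀ one_lt_two hk.ne'
  have hM0 : 0 < M := by linarith
  have hlogb : 0 < Real.logb 2 M := Real.logb_pos one_lt_two hM1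
  have hcard0 : (0 : ℝ) < (QM' m Q Ψ s M).ncard := lt_of_lt_of_le (by positivity) hcard
  have hfin : (QM' m Q Ψ s M).Finite := Set.finite_of_ncard_pos (by exact_mod_cast hcard0)
  obtain ⟨T, hT⟩ := hfin.exists_finset_coe
  rw [← hT, Set.ncard_coe_finset] at hcard hcard0
  have hTQ : ∀ q ∈ T, q ∈ QM Q Ψ s M := fun q hq => by
    have : q ∈ QM' m Q Ψ s M := hT ▸ Finset.mem_coe.2 hq
    exact this.1
  have hT0 : ∀ q ∈ T, q ≠ 0 := fun q hq => ne_zero_of_mem_QM hs hM0 (hTQ q hq)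
  have hl0 : 0 < ‖l‖ := by linarith
  obtain ⟨p, hp⟩ := exists_norm_eq_natAbs hl0
  have hp0 : l p ≠ 0 := by
    rw [hp] at hl0
    exact Int.natAbs_ne_zero.1 (Nat.cast_pos.1 hl0).ne'
  have hterm : ∀ q ∈ T, ‖fcoef (PhiQ φ (Ψ q) q θ) l‖ ≤
      if q ∈ Dset m n l then C * (M * ‖l‖ ^ (-s)) else 0 := by
    intro q hq
    split_ifs with hD
    · obtain ⟨κ, hκ⟩ := hD
      rw [norm_fcoef_PhiQ hmeas hφi (hΨ q).1 (hT0 q hq) θ hκ]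
      exact norm_ftRm_le hΨ hs hKs hC hdecay hM0 (hTQ q hq) hl0 hκ
    · rw [fcoef_PhiQ_eq_zero hmeas _ (hT0 q hq) θ hD, norm_zero]
  have hcount : ((T.filter fun q => q ∈ Dset m n l).card : ℝ) ≤ 2 * (A * wfun ζ ‖l‖) := by
    have h1 := card_le_two_mul_card_divisors hp0 (T := T.filter fun q => q ∈ Dset m n l)
      fun q hq => (Finset.mem_filter.1 hq).2
    have h2 := hdiv (l p).natAbs (by rw [hp] at hl; exact_mod_cast hl)
    rw [← hp] at h2
    calc ((T.filter fun q => q ∈ Dset m n l).card : ℝ)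
        ≤ 2 * ((l p).natAbs.divisors.card : ℝ) := by exact_mod_cast h1
      _ ≤ _ := by gcongr
  have hinv : (T.card : ℝ)⁻¹ ≤ 4 * Real.logb 2 M ^ (n + 1) / M := by
    rw [← inv_div]
    exact inv_anti₀ (by positivity) hcard
  have hw : 0 < wfun ζ ‖l‖ := Real.exp_pos _
  rw [← hT, fcoef_FM_finset hmeas hφi (fun q => (hΨ q).1) θ hT0 l, norm_mul, norm_inv,
    Complex.norm_natCast]
  calc (T.card : ℝ)⁻¹ * ‖∑ q ∈ T, fcoef (PhiQ φ (Ψ q) q θ) l‖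
      ≤ (4 * Real.logb 2 M ^ (n + 1) / M) *
          (2 * (A * wfun ζ ‖l‖) * (C * (M * ‖l‖ ^ (-s)))) := by
        gcongr
        refine (norm_sum_le_of_le T hterm).trans ?_
        rw [← Finset.sum_filter, Finset.sum_const, nsmul_eq_mul]
        gcongr
    _ = 8 * A * C / Real.log 2 ^ (n + 1) * ‖l‖ ^ (-s) * wfun ζ ‖l‖ *
          Real.log M ^ (n + 1) := by
        rw [← Real.log_div_log, div_pow]
        field_simp
        ring
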